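/- arXiv:2409.16390 — 3 statements merged into one kernel-verified Lean document; each statement's English description precedes it below -/
import Mathlib

section
/- Let C~ = C ⊕ C[-1] ⊕ 𝖱 be an S-complex over a commutative ring R, with component maps d, v, δ₁, δ₂, r satisfying d² = 0, δ₁d + rδ₁ = 0, dδ₂ − δ₂r = 0, dv − vd − δ₂δ₁ = 0 and r² = 0. Then the suspension differential d~_Σ and the negative suspension differential d~_{Σ⁻¹} both square to zero: d~_Σ ∘ d~_Σ = 0 and d~_{Σ⁻¹} ∘ d~_{Σ⁻¹} = 0; consequently the suspension ΣC~ and the negative suspension Σ⁻¹C~ are S-complexes. -/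
set_option maxHeartbeats 1000000

open Function

universe u

/-- A `ℤ`-graded `R`-module, presented as an `R`-module together with a family of submodules
(the homogeneous pieces). -/
structure GradedMod (R : Type u) [CommRing R] : Type (u + 1) where
  carrier : Type u
  [isAddCommGroup : AddCommGroup carrier]
  [isModule : Module R carrier]
  grading : ℤ → Submodule R carrier

attribute [instance] GradedMod.isAddCommGroup GradedMod.isModule

namespace GradedMod

variable {R : Type u} [CommRing R]

/-- `f` is homogeneous of degree `k` with respect to the gradings. -/
def IsDeg (M N : GradedMod R) (k : ℤ) (f : M.carrier →ₗ[R] N.carrier) : Prop :=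
  ∀ i : ℤ, (M.grading i).map f ≤ N.grading (i + k)

/-- The grading is an internal direct sum decomposition with finitely generated free pieces,
only finitely many of which are nonzero; i.e., the graded module is finitely generated and
free as a graded `R`-module. -/
def IsFGFree (M : GradedMod R) : Prop :=
  DirectSum.IsInternal M.grading ∧ (∀ i : ℤ, Module.Free R ↥(M.grading i)) ∧
    (∀ i : ℤ, Module.Finite R ↥(M.grading i)) ∧ {i : ℤ | M.grading i ≠ ⊥}.Finite

/-- `e` is the sign operator `ε`, acting on the degree `i` homogeneous part by `(-1)^i`. -/
def IsSign (M : GradedMod R) (e : M.carrier →ₗ[R] M.carrier) : Prop :=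
  ∀ i : ℤ, ∀ x ∈ M.grading i, e x = if Even i then x else -x

/-- The shift `M[n]`, with `M[n]_j = M_{n+j}`. -/
def shift (M : GradedMod R) (n : ℤ) : GradedMod R where
  carrier := M.carrier
  grading j := M.grading (n + j)

/-- Direct sum (product) of graded modules. -/
def prodGM (M N : GradedMod R) : GradedMod R where
  carrier := M.carrier × N.carrier
  grading j := (M.grading j).prod (N.grading j)

/-- Tensor product of graded modules, `(M ⊗ N)_k = ⊕_{i+j=k} M_i ⊗ N_j`. -/
noncomputable def tensorGM (M N : GradedMod R) : GradedMod R where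
  carrier := TensorProduct R M.carrier N.carrier
  grading k := ⨆ i : ℤ, Submodule.map₂ (TensorProduct.mk R M.carrier N.carrier)
      (M.grading i) (N.grading (k - i))

/-- Dual of a graded module: a functional has degree `-i` if it kills all `M_j`, `j ≠ i`. -/
def dualGM (M : GradedMod R) : GradedMod R where
  carrier := Module.Dual R M.carrier
  grading j := ⨅ (i : ℤ) (_ : i ≠ -j), (M.grading i).dualAnnihilator

end GradedMod

variable {R : Type u} [CommRing R]

/-- Iterated composition of a linear endomorphism. -/
def lpow {M : Type u} [AddCommGroup M] [Module R M] (f : M →ₗ[R] M) : ℕ → (M →ₗ[R] M)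
  | 0 => LinearMap.id
  | n + 1 => f ∘ₗ lpow f n

section ProdHelpers

variable {A B C D E : Type u} [AddCommGroup A] [Module R A] [AddCommGroup B] [Module R B]
  [AddCommGroup C] [Module R C] [AddCommGroup D] [Module R D] [AddCommGroup E] [Module R E]

def pj₁ : (A × B × C) →ₗ[R] A := LinearMap.fst R A (B × C)
def pj₂ : (A × B × C) →ₗ[R] B := (LinearMap.fst R B C) ∘ₗ (LinearMap.snd R A (B × C))
def pj₃ : (A × B × C) →ₗ[R] C := (LinearMap.snd R B C) ∘ₗ (LinearMap.snd R A (B × C))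

def tri (f : D →ₗ[R] A) (g : D →ₗ[R] B) (h : D →ₗ[R] C) : D →ₗ[R] A × B × C :=
  f.prod (g.prod h)

def qj₁ : (A × B × C × D) →ₗ[R] A := LinearMap.fst R A (B × C × D)
def qj₂ : (A × B × C × D) →ₗ[R] B := (LinearMap.fst R B (C × D)) ∘ₗ (LinearMap.snd R A (B × C × D))
def qj₃ : (A × B × C × D) →ₗ[R] C :=
  (LinearMap.fst R C D) ∘ₗ (LinearMap.snd R B (C × D)) ∘ₗ (LinearMap.snd R A (B × C × D))
def qj₄ : (A × B × C × D) →ₗ[R] D :=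
  (LinearMap.snd R C D) ∘ₗ (LinearMap.snd R B (C × D)) ∘ₗ (LinearMap.snd R A (B × C × D))

def quad (f : E →ₗ[R] A) (g : E →ₗ[R] B) (h : E →ₗ[R] C) (l : E →ₗ[R] D) :
    E →ₗ[R] A × B × C × D := f.prod (g.prod (h.prod l))

end ProdHelpers

/-- The data of an `S`-complex over `R`: graded modules `C` (irreducible summand) and
`𝖱` (reducible summand), together with the component maps of the differential
`d~ = [[d, 0, 0], [v, −d, δ₂], [δ₁, 0, r]]` with respect to `C~ = C ⊕ C[-1] ⊕ 𝖱`. -/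
structure SCData (R : Type u) [CommRing R] : Type (u + 1) where
  Irr : GradedMod R
  Red : GradedMod R
  d : Irr.carrier →ₗ[R] Irr.carrier
  v : Irr.carrier →ₗ[R] Irr.carrier
  δ₁ : Irr.carrier →ₗ[R] Red.carrier
  δ₂ : Red.carrier →ₗ[R] Irr.carrier
  r : Red.carrier →ₗ[R] Red.carrier

namespace SCData

/-- The five relations equivalent to `d~ ∘ d~ = 0`. -/
def Relations (S : SCData R) : Prop :=
  S.d ∘ₗ S.d = 0 ∧
  S.δ₁ ∘ₗ S.d + S.r ∘ₗ S.δ₁ = 0 ∧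
  S.d ∘ₗ S.δ₂ - S.δ₂ ∘ₗ S.r = 0 ∧
  S.d ∘ₗ S.v - S.v ∘ₗ S.d - S.δ₂ ∘ₗ S.δ₁ = 0 ∧
  S.r ∘ₗ S.r = 0

/-- The degree conditions making `d~` a degree `−1` map on `C~ = C ⊕ C[-1] ⊕ 𝖱`. -/
def Degrees (S : SCData R) : Prop :=
  S.Irr.IsDeg S.Irr (-1) S.d ∧ S.Irr.IsDeg S.Irr (-2) S.v ∧
  S.Irr.IsDeg S.Red (-1) S.δ₁ ∧ S.Red.IsDeg S.Irr (-2) S.δ₂ ∧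
  S.Red.IsDeg S.Red (-1) S.r

/-- `S` is an `S`-complex. -/
def IsSComplex (S : SCData R) : Prop :=
  S.Irr.IsFGFree ∧ S.Red.IsFGFree ∧ S.Degrees ∧ S.Relations

/-- `S` is `r`-perfect: the reducible summand is concentrated in even degrees
(which forces `r = 0` and `δ₁ ∘ v^i ∘ δ₂ = 0` for all `i ≥ 0`). -/
def RPerfect (S : SCData R) : Prop :=
  (∀ j : ℤ, Odd j → S.Red.grading j = ⊥) ∧ S.r = 0 ∧
    ∀ i : ℕ, S.δ₁ ∘ₗ lpow S.v i ∘ₗ S.δ₂ = 0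

/-- The total graded module `C~ = C ⊕ C[-1] ⊕ 𝖱`. -/
def Tot (S : SCData R) : GradedMod R where
  carrier := S.Irr.carrier × S.Irr.carrier × S.Red.carrier
  grading j := (S.Irr.grading j).prod ((S.Irr.grading (j - 1)).prod (S.Red.grading j))

/-- The total differential `d~(c, c', ρ) = (d c, v c − d c' + δ₂ ρ, δ₁ c + r ρ)`. -/
def totalDiff (S : SCData R) : S.Tot.carrier →ₗ[R] S.Tot.carrier :=
  tri (S.d ∘ₗ pj₁) (S.v ∘ₗ pj₁ - S.d ∘ₗ pj₂ + S.δ₂ ∘ₗ pj₃) (S.δ₁ ∘ₗ pj₁ + S.r ∘ₗ pj₃)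

/-- The map `χ(c, c', ρ) = (0, c, 0)`. -/
def totalChi (S : SCData R) : S.Tot.carrier →ₗ[R] S.Tot.carrier :=
  tri 0 pj₁ 0

/-- The suspension `ΣC~`: `C_Σ = C[-2] ⊕ 𝖱[-1]`, `𝖱_Σ = 𝖱`, with the differential of
Definition 2.9 of the paper. -/
def susp (S : SCData R) : SCData R where
  Irr := { carrier := S.Irr.carrier × S.Red.carrier
           grading := fun j => (S.Irr.grading (j - 2)).prod (S.Red.grading (j - 1)) }
  Red := S.Red
  d := LinearMap.prod
      (S.d ∘ₗ LinearMap.fst R S.Irr.carrier S.Red.carrier -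
        S.δ₂ ∘ₗ LinearMap.snd R S.Irr.carrier S.Red.carrier)
      (-(S.r ∘ₗ LinearMap.snd R S.Irr.carrier S.Red.carrier))
  v := LinearMap.prod (S.v ∘ₗ LinearMap.fst R S.Irr.carrier S.Red.carrier)
      (S.δ₁ ∘ₗ LinearMap.fst R S.Irr.carrier S.Red.carrier)
  δ₁ := LinearMap.snd R S.Irr.carrier S.Red.carrier
  δ₂ := LinearMap.prod (S.v ∘ₗ S.δ₂) (S.δ₁ ∘ₗ S.δ₂)
  r := S.r

/-- The negative suspension `Σ⁻¹C~`: `C_{Σ⁻¹} = C[2] ⊕ 𝖱[2]`, `𝖱_{Σ⁻¹} = 𝖱`. -/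
def negSusp (S : SCData R) : SCData R where
  Irr := { carrier := S.Irr.carrier × S.Red.carrier
           grading := fun j => (S.Irr.grading (j + 2)).prod (S.Red.grading (j + 2)) }
  Red := S.Red
  d := LinearMap.prod (S.d ∘ₗ LinearMap.fst R S.Irr.carrier S.Red.carrier)
      (S.δ₁ ∘ₗ LinearMap.fst R S.Irr.carrier S.Red.carrier +
        S.r ∘ₗ LinearMap.snd R S.Irr.carrier S.Red.carrier)
  v := LinearMap.prod (S.v ∘ₗ LinearMap.fst R S.Irr.carrier S.Red.carrier +
        S.δ₂ ∘ₗ LinearMap.snd R S.Irr.carrier S.Red.carrier) 0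
  δ₁ := S.δ₁ ∘ₗ S.v ∘ₗ LinearMap.fst R S.Irr.carrier S.Red.carrier +
        S.δ₁ ∘ₗ S.δ₂ ∘ₗ LinearMap.snd R S.Irr.carrier S.Red.carrier
  δ₂ := LinearMap.prod 0 LinearMap.id
  r := S.r

/-- `Σ^n`, the `n`-fold (negative) suspension. -/
def suspPow (S : SCData R) : ℤ → SCData R
  | Int.ofNat n => (fun X : SCData R => X.susp)^[n] S
  | Int.negSucc n => (fun X : SCData R => X.negSusp)^[n + 1] S

/-- The shifted `S`-complex `C~[n]`: gradings shifted, same differential and `χ`-map. -/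
def shiftSC (S : SCData R) (n : ℤ) : SCData R where
  Irr := S.Irr.shift n
  Red := S.Red.shift n
  d := S.d
  v := S.v
  δ₁ := S.δ₁
  δ₂ := S.δ₂
  r := S.r

end SCData

/-- A map of `S`-complexes in block form `[[λ, 0, 0], [μ, λ, Δ₂], [Δ₁, 0, ρ]]`
(equivalently, a `χ`-equivariant map `C~ → C~'`); used both for morphisms and
(with appropriate signs in the total interpretation) for homotopies. -/
structure SMap {R : Type u} [CommRing R] (S T : SCData R) : Type u where
  lam : S.Irr.carrier →ₗ[R] T.Irr.carrier
  mu : S.Irr.carrier →ₗ[R] T.Irr.carrier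
  del1 : S.Irr.carrier →ₗ[R] T.Red.carrier
  del2 : S.Red.carrier →ₗ[R] T.Irr.carrier
  rho : S.Red.carrier →ₗ[R] T.Red.carrier

namespace SMap

variable {S T U : SCData R}

/-- The component relations equivalent to `d~' λ~ = λ~ d~`. -/
def IsMor (f : SMap S T) : Prop :=
  T.d ∘ₗ f.lam - f.lam ∘ₗ S.d = 0 ∧
  f.del1 ∘ₗ S.d + f.rho ∘ₗ S.δ₁ - T.δ₁ ∘ₗ f.lam - T.r ∘ₗ f.del1 = 0 ∧
  T.d ∘ₗ f.del2 - T.δ₂ ∘ₗ f.rho + f.lam ∘ₗ S.δ₂ + f.del2 ∘ₗ S.r = 0 ∧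
  f.mu ∘ₗ S.d + T.d ∘ₗ f.mu + f.lam ∘ₗ S.v - T.v ∘ₗ f.lam + f.del2 ∘ₗ S.δ₁ - T.δ₂ ∘ₗ f.del1 = 0 ∧
  f.rho ∘ₗ S.r - T.r ∘ₗ f.rho = 0

/-- The components have the degrees of a degree `k` map of `S`-complexes. -/
def DegreesAt (f : SMap S T) (k : ℤ) : Prop :=
  S.Irr.IsDeg T.Irr k f.lam ∧ S.Irr.IsDeg T.Irr (k - 1) f.mu ∧
  S.Irr.IsDeg T.Red k f.del1 ∧ S.Red.IsDeg T.Irr (k - 1) f.del2 ∧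
  S.Red.IsDeg T.Red k f.rho

/-- Composition of morphisms of `S`-complexes, componentwise. -/
def comp (g : SMap T U) (f : SMap S T) : SMap S U where
  lam := g.lam ∘ₗ f.lam
  mu := g.lam ∘ₗ f.mu + g.mu ∘ₗ f.lam + g.del2 ∘ₗ f.del1
  del1 := g.del1 ∘ₗ f.lam + g.rho ∘ₗ f.del1
  del2 := g.lam ∘ₗ f.del2 + g.del2 ∘ₗ f.rho
  rho := g.rho ∘ₗ f.rho

/-- `K` is an `S`-chain homotopy from `f` to `g`, i.e. `d~' K~ + K~ d~ = λ~ - λ~'` where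
`K~ = [[K, 0, 0], [L, -K, M₂], [M₁, 0, J]]`, in component form. -/
def IsHtpyFrom (K f g : SMap S T) : Prop :=
  T.d ∘ₗ K.lam + K.lam ∘ₗ S.d - f.lam + g.lam = 0 ∧
  T.δ₁ ∘ₗ K.lam + T.r ∘ₗ K.del1 + K.del1 ∘ₗ S.d + K.rho ∘ₗ S.δ₁ - f.del1 + g.del1 = 0 ∧
  -(T.d ∘ₗ K.del2) + T.δ₂ ∘ₗ K.rho - K.lam ∘ₗ S.δ₂ + K.del2 ∘ₗ S.r - f.del2 + g.del2 = 0 ∧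
  T.v ∘ₗ K.lam - T.d ∘ₗ K.mu + T.δ₂ ∘ₗ K.del1 + K.mu ∘ₗ S.d - K.lam ∘ₗ S.v + K.del2 ∘ₗ S.δ₁
    - f.mu + g.mu = 0 ∧
  T.r ∘ₗ K.rho + K.rho ∘ₗ S.r - f.rho + g.rho = 0

end SMap

/-- The identity morphism. -/
def idMap (S : SCData R) : SMap S S where
  lam := LinearMap.id
  mu := 0
  del1 := 0
  del2 := 0
  rho := LinearMap.id

/-- The total map `C~ → C~'` of a morphism in block form. -/
def morTotal {S T : SCData R} (f : SMap S T) : S.Tot.carrier →ₗ[R] T.Tot.carrier :=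
  tri (f.lam ∘ₗ pj₁) (f.mu ∘ₗ pj₁ + f.lam ∘ₗ pj₂ + f.del2 ∘ₗ pj₃) (f.del1 ∘ₗ pj₁ + f.rho ∘ₗ pj₃)

/-- The total map `C~ → C~'` of a homotopy in block form. -/
def htpTotal {S T : SCData R} (K : SMap S T) : S.Tot.carrier →ₗ[R] T.Tot.carrier :=
  tri (K.lam ∘ₗ pj₁) (K.mu ∘ₗ pj₁ - K.lam ∘ₗ pj₂ + K.del2 ∘ₗ pj₃) (K.del1 ∘ₗ pj₁ + K.rho ∘ₗ pj₃)

/-- `S`-chain homotopy equivalence of `S`-complexes. -/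
def SHomotopyEquiv (S T : SCData R) : Prop :=
  ∃ (f : SMap S T) (g : SMap T S) (H₁ : SMap S S) (H₂ : SMap T T),
    f.IsMor ∧ f.DegreesAt 0 ∧ g.IsMor ∧ g.DegreesAt 0 ∧
    H₁.DegreesAt 1 ∧ SMap.IsHtpyFrom H₁ (g.comp f) (idMap S) ∧
    H₂.DegreesAt 1 ∧ SMap.IsHtpyFrom H₂ (f.comp g) (idMap T)

/-- Isomorphism of `S`-complexes: a (degree `0`) morphism with a two-sided inverse morphism. -/
def SIso (S T : SCData R) : Prop :=
  ∃ (f : SMap S T) (g : SMap T S), f.IsMor ∧ f.DegreesAt 0 ∧ g.IsMor ∧ g.DegreesAt 0 ∧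
    g.comp f = idMap S ∧ f.comp g = idMap T

/-- The suspension `Σλ~` of a morphism `λ~`, in block form. -/
def suspMap {S T : SCData R} (f : SMap S T) : SMap S.susp T.susp where
  lam := LinearMap.prod
      (f.lam ∘ₗ LinearMap.fst R S.Irr.carrier S.Red.carrier +
        f.del2 ∘ₗ LinearMap.snd R S.Irr.carrier S.Red.carrier)
      (f.rho ∘ₗ LinearMap.snd R S.Irr.carrier S.Red.carrier)
  mu := LinearMap.prod (f.mu ∘ₗ LinearMap.fst R S.Irr.carrier S.Red.carrier)
      (f.del1 ∘ₗ LinearMap.fst R S.Irr.carrier S.Red.carrier)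
  del1 := 0
  del2 := LinearMap.prod (f.mu ∘ₗ S.δ₂ + T.v ∘ₗ f.del2) (f.del1 ∘ₗ S.δ₂ + T.δ₁ ∘ₗ f.del2)
  rho := f.rho

/-- The suspension `ΣK~` of a homotopy `K~`, in block form. -/
def suspHtpy {S T : SCData R} (K : SMap S T) : SMap S.susp T.susp where
  lam := LinearMap.prod
      (K.lam ∘ₗ LinearMap.fst R S.Irr.carrier S.Red.carrier -
        K.del2 ∘ₗ LinearMap.snd R S.Irr.carrier S.Red.carrier)
      (-(K.rho ∘ₗ LinearMap.snd R S.Irr.carrier S.Red.carrier))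
  mu := LinearMap.prod (K.mu ∘ₗ LinearMap.fst R S.Irr.carrier S.Red.carrier)
      (K.del1 ∘ₗ LinearMap.fst R S.Irr.carrier S.Red.carrier)
  del1 := 0
  del2 := LinearMap.prod (T.v ∘ₗ K.del2 + K.mu ∘ₗ S.δ₂) (T.δ₁ ∘ₗ K.del2 + K.del1 ∘ₗ S.δ₂)
  rho := K.rho

/-- The sequence `τ_0 = ρ`, `τ_{i+1} = δ₁'v'^iΔ₂ + Δ₁v^iδ₂ + Σ_{j<i} δ₁'v'^j μ v^{i−1−j} δ₂`
attached to an (even degree) morphism between `r`-perfect `S`-complexes. -/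
def tauSMap {S T : SCData R} (f : SMap S T) : ℕ → (S.Red.carrier →ₗ[R] T.Red.carrier)
  | 0 => f.rho
  | i + 1 =>
      T.δ₁ ∘ₗ lpow T.v i ∘ₗ f.del2 + f.del1 ∘ₗ lpow S.v i ∘ₗ S.δ₂ +
        ∑ j ∈ Finset.range i, T.δ₁ ∘ₗ lpow T.v j ∘ₗ f.mu ∘ₗ lpow S.v (i - 1 - j) ∘ₗ S.δ₂

/-- Height `n` (for `n ≥ 0`): `τ_j = 0` for `0 ≤ j < n`. -/
def SMap.HasHeight {S T : SCData R} (f : SMap S T) (n : ℕ) : Prop :=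
  ∀ j : ℕ, j < n → tauSMap f j = 0

/-- Strong height `n`: height `n` and `τ_n` an isomorphism. -/
def SMap.StrongHeight {S T : SCData R} (f : SMap S T) (n : ℕ) : Prop :=
  f.HasHeight n ∧ Function.Bijective ⇑(tauSMap f n)

/-- The explicit model of the `n`-fold suspension `Σ^n C~` of an `r`-perfect `S`-complex:
`C_{Σ^n} = C[-2n] ⊕ ⊕_{i=0}^{n-1} 𝖱[-2i-1]` (the `m`-th factor of `Fin n → 𝖱` being
`𝖱[-2(n-1-m)-1]`), `𝖱_{Σ^n} = 𝖱`, with the components of the differential as in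
Subsection 2.4 of the paper. -/
def SCData.suspN (S : SCData R) (n : ℕ) : SCData R where
  Irr := { carrier := S.Irr.carrier × (Fin n → S.Red.carrier)
           grading := fun j => (S.Irr.grading (j - 2 * (n : ℤ))).prod
             (Submodule.pi Set.univ fun m : Fin n =>
               S.Red.grading (j - 2 * (((n - 1 - (m : ℕ) : ℕ)) : ℤ) - 1)) }
  Red := S.Red
  d := LinearMap.prod
      (S.d ∘ₗ LinearMap.fst R S.Irr.carrier (Fin n → S.Red.carrier) -
        ∑ m : Fin n, lpow S.v (m : ℕ) ∘ₗ S.δ₂ ∘ₗ LinearMap.proj m ∘ₗ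
          LinearMap.snd R S.Irr.carrier (Fin n → S.Red.carrier)) 0
  v := LinearMap.prod (S.v ∘ₗ LinearMap.fst R S.Irr.carrier (Fin n → S.Red.carrier))
      (LinearMap.pi fun m : Fin n =>
        if (m : ℕ) = 0 then S.δ₁ ∘ₗ LinearMap.fst R S.Irr.carrier (Fin n → S.Red.carrier)
        else LinearMap.proj (⟨(m : ℕ) - 1, lt_of_le_of_lt (Nat.sub_le _ _) m.isLt⟩ : Fin n) ∘ₗ
          LinearMap.snd R S.Irr.carrier (Fin n → S.Red.carrier))
  δ₁ := if h : 0 < n then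
      LinearMap.proj (⟨n - 1, Nat.sub_lt h Nat.one_pos⟩ : Fin n) ∘ₗ
        LinearMap.snd R S.Irr.carrier (Fin n → S.Red.carrier)
    else 0
  δ₂ := LinearMap.prod (lpow S.v n ∘ₗ S.δ₂) 0
  r := 0

/-- The natural morphism `ι~_n : C~ → Σ^n C~`, with `λ`-component `c ↦ (c, 0, …, 0)` and
`Δ₂`-component `θ ↦ (0, θ, 0, …, 0)`. -/
def iotaN (S : SCData R) (n : ℕ) : SMap S (S.suspN n) where
  lam := LinearMap.prod LinearMap.id 0
  mu := 0
  del1 := 0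
  del2 := LinearMap.prod 0 (LinearMap.pi fun m : Fin n => if (m : ℕ) = 0 then LinearMap.id else 0)
  rho := 0

/-- The data of a generalized height morphism between `r`-perfect `S`-complexes:
the four maps `λ, μ, Δ₁, Δ₂` and the sequence `τ_i` for `i ∈ ℤ`. -/
structure HMor {R : Type u} [CommRing R] (S T : SCData R) : Type u where
  lam : S.Irr.carrier →ₗ[R] T.Irr.carrier
  mu : S.Irr.carrier →ₗ[R] T.Irr.carrier
  del1 : S.Irr.carrier →ₗ[R] T.Red.carrier
  del2 : S.Red.carrier →ₗ[R] T.Irr.carrier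
  tau : ℤ → (S.Red.carrier →ₗ[R] T.Red.carrier)

/-- `f` is a height `n` morphism of (even) degree `k` between `r`-perfect `S`-complexes. -/
def HMor.IsHeightMor {S T : SCData R} (f : HMor S T) (n : ℤ) (k : ℤ) : Prop :=
  Even k ∧
  S.Irr.IsDeg T.Irr k f.lam ∧ S.Irr.IsDeg T.Irr (k - 1) f.mu ∧
  S.Irr.IsDeg T.Red k f.del1 ∧ S.Red.IsDeg T.Irr (k - 1) f.del2 ∧
  (∀ i : ℤ, S.Red.IsDeg T.Red (k - 2 * i) (f.tau i)) ∧
  (∀ i : ℤ, i < n → f.tau i = 0) ∧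
  (∀ i : ℕ, f.tau ((i : ℤ) + 1) =
      T.δ₁ ∘ₗ lpow T.v i ∘ₗ f.del2 + f.del1 ∘ₗ lpow S.v i ∘ₗ S.δ₂ +
        ∑ j ∈ Finset.range i, T.δ₁ ∘ₗ lpow T.v j ∘ₗ f.mu ∘ₗ lpow S.v (i - 1 - j) ∘ₗ S.δ₂) ∧
  (T.d ∘ₗ f.lam - f.lam ∘ₗ S.d -
      ∑ᶠ i : ℕ, ∑ j ∈ Finset.range (i + 1),
        lpow T.v j ∘ₗ T.δ₂ ∘ₗ f.tau (-((i : ℤ) + 1)) ∘ₗ S.δ₁ ∘ₗ lpow S.v (i - j) = 0) ∧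
  (-(T.δ₁ ∘ₗ f.lam) + f.del1 ∘ₗ S.d + ∑ᶠ i : ℕ, f.tau (-(i : ℤ)) ∘ₗ S.δ₁ ∘ₗ lpow S.v i = 0) ∧
  (f.lam ∘ₗ S.δ₂ + T.d ∘ₗ f.del2 - ∑ᶠ i : ℕ, lpow T.v i ∘ₗ T.δ₂ ∘ₗ f.tau (-(i : ℤ)) = 0) ∧
  (f.mu ∘ₗ S.d + T.d ∘ₗ f.mu + f.lam ∘ₗ S.v - T.v ∘ₗ f.lam + f.del2 ∘ₗ S.δ₁ - T.δ₂ ∘ₗ f.del1 = 0)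

/-- Composition of generalized height morphisms (Definition 2.23 of the paper). -/
noncomputable def HMor.compH {S T U : SCData R} (g : HMor T U) (f : HMor S T) : HMor S U where
  lam := g.lam ∘ₗ f.lam
    + (∑ᶠ i : ℕ, ∑ j ∈ Finset.range (i + 1),
        lpow U.v j ∘ₗ U.δ₂ ∘ₗ g.tau (-((i : ℤ) + 1)) ∘ₗ f.del1 ∘ₗ lpow S.v (i - j))
    + (∑ᶠ i : ℕ, ∑ j ∈ Finset.range (i + 1),
        lpow U.v j ∘ₗ g.del2 ∘ₗ f.tau (-((i : ℤ) + 1)) ∘ₗ S.δ₁ ∘ₗ lpow S.v (i - j))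
    + (∑ᶠ i : ℕ, ∑ j ∈ Finset.range (i + 1), ∑ l ∈ Finset.range (i - j + 1),
        lpow U.v j ∘ₗ U.δ₂ ∘ₗ g.tau (-((i : ℤ) + 2)) ∘ₗ T.δ₁ ∘ₗ lpow T.v l ∘ₗ f.mu ∘ₗ
          lpow S.v (i - j - l))
    + (∑ᶠ i : ℕ, ∑ j ∈ Finset.range (i + 1), ∑ l ∈ Finset.range (i - j + 1),
        lpow U.v j ∘ₗ g.mu ∘ₗ lpow T.v l ∘ₗ T.δ₂ ∘ₗ f.tau (-((i : ℤ) + 2)) ∘ₗ S.δ₁ ∘ₗ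
          lpow S.v (i - j - l))
  mu := g.lam ∘ₗ f.mu + g.mu ∘ₗ f.lam + g.del2 ∘ₗ f.del1
  del1 := g.del1 ∘ₗ f.lam + (∑ᶠ i : ℕ, g.tau (-(i : ℤ)) ∘ₗ f.del1 ∘ₗ lpow S.v i)
    + (∑ᶠ i : ℕ, ∑ j ∈ Finset.range (i + 1),
        g.tau (-((i : ℤ) + 1)) ∘ₗ T.δ₁ ∘ₗ lpow T.v j ∘ₗ f.mu ∘ₗ lpow S.v (i - j))
  del2 := g.lam ∘ₗ f.del2 + (∑ᶠ i : ℕ, lpow U.v i ∘ₗ g.del2 ∘ₗ f.tau (-(i : ℤ)))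
    + (∑ᶠ i : ℕ, ∑ j ∈ Finset.range (i + 1),
        lpow U.v j ∘ₗ g.mu ∘ₗ lpow T.v (i - j) ∘ₗ T.δ₂ ∘ₗ f.tau (-((i : ℤ) + 1)))
  tau := fun i => ∑ᶠ l : ℤ, g.tau (i - l) ∘ₗ f.tau l

/-- The strong height `−n` morphism `κ~_n : Σ^n C~ → C~`. -/
def kappaN (T : SCData R) (n : ℕ) : HMor (T.suspN n) T where
  lam := LinearMap.fst R T.Irr.carrier (Fin n → T.Red.carrier)
  mu := 0
  del1 := 0
  del2 := 0
  tau := fun i => if i = -(n : ℤ) then LinearMap.id else 0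

/-- An (even degree) morphism of `S`-complexes, regarded as a generalized height morphism. -/
def SMap.toHMor {S T : SCData R} (f : SMap S T) : HMor S T where
  lam := f.lam
  mu := f.mu
  del1 := f.del1
  del2 := f.del2
  tau := fun i => if 0 ≤ i then tauSMap f i.toNat else 0

/-- The height `0` morphism `λ~' : C~ → Σ^n C~'` associated to a height `−n` morphism
(Proposition 2.25 of the paper). -/
def heightNegToSusp {S T : SCData R} (f : HMor S T) (n : ℕ) : SMap S (T.suspN n) where
  lam := LinearMap.prod f.lam
    (LinearMap.pi fun m : Fin n =>
      ∑ i ∈ Finset.Icc ((m : ℕ) + 1) n, f.tau (-(i : ℤ)) ∘ₗ S.δ₁ ∘ₗ lpow S.v (i - 1 - (m : ℕ)))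
  mu := LinearMap.prod f.mu (LinearMap.pi fun m : Fin n => if (m : ℕ) = 0 then f.del1 else 0)
  del1 := 0
  del2 := LinearMap.prod f.del2 (LinearMap.pi fun m : Fin n => f.tau (-((m : ℕ) : ℤ)))
  rho := f.tau (-(n : ℤ))

/-- The morphism `ι~₁ : C~ → ΣC~`. -/
def iotaOne (S : SCData R) : SMap S S.susp where
  lam := LinearMap.prod LinearMap.id 0
  mu := 0
  del1 := 0
  del2 := LinearMap.prod 0 LinearMap.id
  rho := 0

/-- The morphism `λ~'' : ΣC~' → C~''` associated to an odd degree morphism `λ~'` together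
with the map `ν' : 𝖱' → 𝖱''` (Subsection 2.6 of the paper). -/
def lambdaSecond {S T : SCData R} (f : SMap S T) (nu : S.Red.carrier →ₗ[R] T.Red.carrier) :
    SMap S.susp T where
  lam := f.lam ∘ₗ LinearMap.fst R S.Irr.carrier S.Red.carrier +
    f.del2 ∘ₗ LinearMap.snd R S.Irr.carrier S.Red.carrier
  mu := f.mu ∘ₗ LinearMap.fst R S.Irr.carrier S.Red.carrier
  del1 := f.del1 ∘ₗ LinearMap.fst R S.Irr.carrier S.Red.carrier +
    nu ∘ₗ LinearMap.snd R S.Irr.carrier S.Red.carrier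
  del2 := f.mu ∘ₗ S.δ₂ + T.v ∘ₗ f.del2 + T.δ₂ ∘ₗ nu
  rho := 0

/-- The morphism `λ~₁ : C~ → ΣC~'` associated to height `−1` morphism data
`(λ, μ, Δ₁, Δ₂, τ₀, τ₋₁)`, in block form
`[[λ, 0, 0], [τ₋₁δ₁, 0, 0], [μ, λ, Δ₂], [Δ₁, τ₋₁δ₁, τ₀], [0, 0, τ₋₁]]`. -/
def hNegOneSusp {S T : SCData R} (lam0 mu0 : S.Irr.carrier →ₗ[R] T.Irr.carrier)
    (del10 : S.Irr.carrier →ₗ[R] T.Red.carrier) (del20 : S.Red.carrier →ₗ[R] T.Irr.carrier)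
    (tau0 taum1 : S.Red.carrier →ₗ[R] T.Red.carrier) : SMap S T.susp where
  lam := LinearMap.prod lam0 (taum1 ∘ₗ S.δ₁)
  mu := LinearMap.prod mu0 del10
  del1 := 0
  del2 := LinearMap.prod del20 tau0
  rho := taum1

/-- The mapping cone of a degree `k` morphism `λ~ : C~ → C~'`, as an `S`-complex;
its underlying graded module is `C~[-1-k] ⊕ C~'`. -/
def coneSC {S T : SCData R} (f : SMap S T) (k : ℤ) : SCData R where
  Irr := { carrier := S.Irr.carrier × T.Irr.carrier
           grading := fun j => (S.Irr.grading (j - 1 - k)).prod (T.Irr.grading j) }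
  Red := { carrier := S.Red.carrier × T.Red.carrier
           grading := fun j => (S.Red.grading (j - 1 - k)).prod (T.Red.grading j) }
  d := LinearMap.prod (-(S.d ∘ₗ LinearMap.fst R S.Irr.carrier T.Irr.carrier))
      (f.lam ∘ₗ LinearMap.fst R S.Irr.carrier T.Irr.carrier +
        T.d ∘ₗ LinearMap.snd R S.Irr.carrier T.Irr.carrier)
  v := LinearMap.prod (S.v ∘ₗ LinearMap.fst R S.Irr.carrier T.Irr.carrier)
      (f.mu ∘ₗ LinearMap.fst R S.Irr.carrier T.Irr.carrier +
        T.v ∘ₗ LinearMap.snd R S.Irr.carrier T.Irr.carrier)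
  δ₁ := LinearMap.prod (-(S.δ₁ ∘ₗ LinearMap.fst R S.Irr.carrier T.Irr.carrier))
      (f.del1 ∘ₗ LinearMap.fst R S.Irr.carrier T.Irr.carrier +
        T.δ₁ ∘ₗ LinearMap.snd R S.Irr.carrier T.Irr.carrier)
  δ₂ := LinearMap.prod (S.δ₂ ∘ₗ LinearMap.fst R S.Red.carrier T.Red.carrier)
      (f.del2 ∘ₗ LinearMap.fst R S.Red.carrier T.Red.carrier +
        T.δ₂ ∘ₗ LinearMap.snd R S.Red.carrier T.Red.carrier)
  r := LinearMap.prod (-(S.r ∘ₗ LinearMap.fst R S.Red.carrier T.Red.carrier))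
      (f.rho ∘ₗ LinearMap.fst R S.Red.carrier T.Red.carrier +
        T.r ∘ₗ LinearMap.snd R S.Red.carrier T.Red.carrier)

/-- Direct sum of `S`-complexes. -/
def sumSC (S T : SCData R) : SCData R where
  Irr := S.Irr.prodGM T.Irr
  Red := S.Red.prodGM T.Red
  d := S.d.prodMap T.d
  v := S.v.prodMap T.v
  δ₁ := S.δ₁.prodMap T.δ₁
  δ₂ := S.δ₂.prodMap T.δ₂
  r := S.r.prodMap T.r

/-- The dual `S`-complex `C~†`, defined using sign operators on the dual graded modules:
`m†(f) = −ε(f) f ∘ m`, with the roles of `δ₁` and `δ₂` interchanged. -/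
def dualSC (S : SCData R)
    (eCd : Module.Dual R S.Irr.carrier →ₗ[R] Module.Dual R S.Irr.carrier)
    (eRd : Module.Dual R S.Red.carrier →ₗ[R] Module.Dual R S.Red.carrier) : SCData R where
  Irr := S.Irr.dualGM
  Red := S.Red.dualGM
  d := -(S.d.dualMap ∘ₗ eCd)
  v := -(S.v.dualMap ∘ₗ eCd)
  δ₁ := -(S.δ₂.dualMap ∘ₗ eCd)
  δ₂ := -(S.δ₁.dualMap ∘ₗ eRd)
  r := -(S.r.dualMap ∘ₗ eRd)

/-- The rank-one graded module `R`, concentrated in degree `n`. -/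
def unitGM (R : Type u) [CommRing R] (n : ℤ) : GradedMod R where
  carrier := R
  grading j := if j = n then ⊤ else ⊥

/-- The `S`-complex `O~(1)`: `C = R` in degree `1`, `𝖱 = R` in degree `0`, `δ₁ = id`. -/
def O1 (R : Type u) [CommRing R] : SCData R where
  Irr := unitGM R 1
  Red := unitGM R 0
  d := 0
  v := 0
  δ₁ := LinearMap.id
  δ₂ := 0
  r := 0

/-- The `S`-complex `O~(-1)`: `C = R` in degree `-2`, `𝖱 = R` in degree `0`, `δ₂ = id`. -/
def Om1 (R : Type u) [CommRing R] : SCData R where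
  Irr := unitGM R (-2)
  Red := unitGM R 0
  d := 0
  v := 0
  δ₁ := 0
  δ₂ := LinearMap.id
  r := 0

/-- The `S`-complex `O~(0)`: `C = 0`, `𝖱 = R` in degree `0`, zero differential. -/
def O0 (R : Type u) [CommRing R] : SCData R where
  Irr := { carrier := ↥(⊥ : Submodule R R), grading := fun _ => ⊥ }
  Red := unitGM R 0
  d := 0
  v := 0
  δ₁ := 0
  δ₂ := 0
  r := 0

/-- The `S`-complex representation of the tensor product `C~ ⊗ C~'` of `S`-complexes
(Subsection 2.2 of the paper), where `eC`, `eR` are the sign operators of the first factor: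
`C^⊗ = (C⊗C') ⊕ (C⊗C')[-1] ⊕ (C⊗𝖱') ⊕ (𝖱⊗C')` and `𝖱^⊗ = 𝖱⊗𝖱'`. -/
noncomputable def tensorRep (S T : SCData R)
    (eC : S.Irr.carrier →ₗ[R] S.Irr.carrier) (eR : S.Red.carrier →ₗ[R] S.Red.carrier) :
    SCData R where
  Irr := (S.Irr.tensorGM T.Irr).prodGM (((S.Irr.tensorGM T.Irr).shift (-1)).prodGM
      ((S.Irr.tensorGM T.Red).prodGM (S.Red.tensorGM T.Irr)))
  Red := S.Red.tensorGM T.Red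
  d := quad
      (TensorProduct.map S.d LinearMap.id ∘ₗ qj₁ + TensorProduct.map eC T.d ∘ₗ qj₁)
      (TensorProduct.map (-(eC ∘ₗ S.v)) LinearMap.id ∘ₗ qj₁ + TensorProduct.map eC T.v ∘ₗ qj₁
        + TensorProduct.map S.d LinearMap.id ∘ₗ qj₂ - TensorProduct.map eC T.d ∘ₗ qj₂
        + TensorProduct.map eC T.δ₂ ∘ₗ qj₃
        + TensorProduct.map (-(eC ∘ₗ S.δ₂)) LinearMap.id ∘ₗ qj₄)
      (TensorProduct.map eC T.δ₁ ∘ₗ qj₁ + TensorProduct.map S.d LinearMap.id ∘ₗ qj₃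
        + TensorProduct.map eC T.r ∘ₗ qj₃)
      (TensorProduct.map S.δ₁ LinearMap.id ∘ₗ qj₁ + TensorProduct.map eR T.d ∘ₗ qj₄
        + TensorProduct.map S.r LinearMap.id ∘ₗ qj₄)
  v := quad
      (TensorProduct.map S.v LinearMap.id ∘ₗ qj₁ + TensorProduct.map S.δ₂ LinearMap.id ∘ₗ qj₄)
      (TensorProduct.map S.v LinearMap.id ∘ₗ qj₂)
      (TensorProduct.map S.v LinearMap.id ∘ₗ qj₃)
      (TensorProduct.map (eR ∘ₗ S.δ₁) LinearMap.id ∘ₗ qj₂ + TensorProduct.map LinearMap.id T.v ∘ₗ qj₄)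
  δ₁ := TensorProduct.map S.δ₁ LinearMap.id ∘ₗ qj₃ + TensorProduct.map eR T.δ₁ ∘ₗ qj₄
  δ₂ := quad 0 0 (TensorProduct.map S.δ₂ LinearMap.id) (TensorProduct.map LinearMap.id T.δ₂)
  r := TensorProduct.map S.r LinearMap.id + TensorProduct.map eR T.r

/-- Homology of an endomorphism (thought of as a differential): `ker D / im D`. -/
abbrev homologyOf {M : Type u} [AddCommGroup M] [Module R M] (D : M →ₗ[R] M) : Type u :=
  ↥(LinearMap.ker D) ⧸
    Submodule.comap (LinearMap.ker D).subtype (LinearMap.range D)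

/-- The map induced on homology by a chain map. -/
def inducedMap {M N : Type u} [AddCommGroup M] [Module R M] [AddCommGroup N] [Module R N]
    (DM : M →ₗ[R] M) (DN : N →ₗ[R] N) (f : M →ₗ[R] N) (h : DN ∘ₗ f = f ∘ₗ DM) :
    homologyOf DM →ₗ[R] homologyOf DN :=
  Submodule.mapQ _ _
    (f.restrict (p := LinearMap.ker DM) (q := LinearMap.ker DN) (fun x hx => by
      have h1 : DN (f x) = f (DM x) := by
        have h2 := LinearMap.congr_fun h x
        simpa using h2
      have hx0 : DM x = 0 := LinearMap.mem_ker.mp hx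
      simp [LinearMap.mem_ker, h1, hx0]))
    (by
      intro x hx
      simp only [Submodule.mem_comap] at hx ⊢
      obtain ⟨y, hy⟩ := hx
      refine ⟨f y, ?_⟩
      have h1 : DN (f y) = f (DM y) := by
        have h2 := LinearMap.congr_fun h y
        simpa using h2
      simp only [Submodule.coe_subtype] at hy ⊢
      rw [LinearMap.restrict_apply]
      rw [h1, hy])

/-- The degree `j` homology of a graded module with a (degree `-1`) differential. -/
abbrev gradedHomology (M : GradedMod R) (D : M.carrier →ₗ[R] M.carrier) (j : ℤ) : Type u :=
  ↥(M.grading j ⊓ LinearMap.ker D) ⧸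
    Submodule.comap (M.grading j ⊓ LinearMap.ker D).subtype ((M.grading (j + 1)).map D)

/-- The Euler characteristic `Σ_j (-1)^j rk_R M_j` of a graded module. -/
noncomputable def eulerChar (M : GradedMod R) : ℤ :=
  ∑ᶠ j : ℤ, (if Even j then (1 : ℤ) else -1) * (Module.finrank R ↥(M.grading j) : ℤ)

/-- The small equivariant complex `Ĉ = C[-1] ⊕ 𝖱[x]`, with `𝖱[x]` modelled as `ℕ →₀ 𝖱`. -/
abbrev hatC (S : SCData R) : Type u := S.Irr.carrier × (ℕ →₀ S.Red.carrier)

/-- The differential `𝔡̂(α, θxⁱ) = (dα − vⁱδ₂θ, 0)`. -/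
noncomputable def hatD (S : SCData R) : hatC S →ₗ[R] hatC S :=
  LinearMap.prod
    (S.d ∘ₗ LinearMap.fst R S.Irr.carrier (ℕ →₀ S.Red.carrier) -
      (Finsupp.lsum ℕ fun i : ℕ => lpow S.v i ∘ₗ S.δ₂) ∘ₗ
        LinearMap.snd R S.Irr.carrier (ℕ →₀ S.Red.carrier))
    0

/-- The `x`-action `x·(α, θxⁱ) = (vα, δ₁α + θx^{i+1})` on `Ĉ`. -/
noncomputable def hatX (S : SCData R) : hatC S →ₗ[R] hatC S :=
  LinearMap.prod (S.v ∘ₗ LinearMap.fst R S.Irr.carrier (ℕ →₀ S.Red.carrier))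
    (Finsupp.lsingle 0 ∘ₗ S.δ₁ ∘ₗ LinearMap.fst R S.Irr.carrier (ℕ →₀ S.Red.carrier) +
      Finsupp.lmapDomain S.Red.carrier R (fun i => i + 1) ∘ₗ
        LinearMap.snd R S.Irr.carrier (ℕ →₀ S.Red.carrier))

/-- The small equivariant complex `Č = C ⊕ 𝖱[[x⁻¹,x]/𝖱[x]`, the tail modelled as `ℕ → 𝖱`
(the `m`-th coordinate is the coefficient of `x^{-m-1}`). -/
abbrev checkC (S : SCData R) : Type u := S.Irr.carrier × (ℕ → S.Red.carrier)

/-- The differential `𝔡̌(α, θxⁱ) = (dα, Σ_{j≤-1} δ₁v^{−j−1}(α)xʲ)`. -/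
noncomputable def checkD (S : SCData R) : checkC S →ₗ[R] checkC S :=
  LinearMap.prod (S.d ∘ₗ LinearMap.fst R S.Irr.carrier (ℕ → S.Red.carrier))
    (LinearMap.pi fun m : ℕ =>
      S.δ₁ ∘ₗ lpow S.v m ∘ₗ LinearMap.fst R S.Irr.carrier (ℕ → S.Red.carrier))

/-- The `x`-action on `Č`. -/
noncomputable def checkX (S : SCData R) : checkC S →ₗ[R] checkC S :=
  LinearMap.prod
    (S.v ∘ₗ LinearMap.fst R S.Irr.carrier (ℕ → S.Red.carrier) +
      S.δ₂ ∘ₗ LinearMap.proj 0 ∘ₗ LinearMap.snd R S.Irr.carrier (ℕ → S.Red.carrier))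
    (LinearMap.pi fun m : ℕ =>
      LinearMap.proj (m + 1) ∘ₗ LinearMap.snd R S.Irr.carrier (ℕ → S.Red.carrier))

/-- The module `𝖱[[x⁻¹,x]` of Laurent series with finitely many positive powers, modelled
as (polynomial part, tail): `(ℕ →₀ 𝖱) × (ℕ → 𝖱)`. -/
abbrev barC (S : SCData R) : Type u := (ℕ →₀ S.Red.carrier) × (ℕ → S.Red.carrier)

/-- Multiplication by `x` on `𝖱[[x⁻¹,x]`. -/
noncomputable def barX (S : SCData R) : barC S →ₗ[R] barC S :=
  LinearMap.prod
    (Finsupp.lsingle 0 ∘ₗ LinearMap.proj 0 ∘ₗ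
        LinearMap.snd R (ℕ →₀ S.Red.carrier) (ℕ → S.Red.carrier) +
      Finsupp.lmapDomain S.Red.carrier R (fun i => i + 1) ∘ₗ
        LinearMap.fst R (ℕ →₀ S.Red.carrier) (ℕ → S.Red.carrier))
    (LinearMap.pi fun m : ℕ =>
      LinearMap.proj (m + 1) ∘ₗ LinearMap.snd R (ℕ →₀ S.Red.carrier) (ℕ → S.Red.carrier))

/-- The chain map `𝔦 : Ĉ → 𝖱[[x⁻¹,x]`, `(α, θ) ↦ Σ_{i≤-1} δ₁v^{−i−1}(α)xⁱ + θ`. -/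
noncomputable def mapI (S : SCData R) : hatC S →ₗ[R] barC S :=
  LinearMap.prod (LinearMap.snd R S.Irr.carrier (ℕ →₀ S.Red.carrier))
    (LinearMap.pi fun m : ℕ =>
      S.δ₁ ∘ₗ lpow S.v m ∘ₗ LinearMap.fst R S.Irr.carrier (ℕ →₀ S.Red.carrier))

/-- The chain map `𝔧 : Č → Ĉ`, `(α, ·) ↦ (−α, 0)`. -/
noncomputable def mapJ (S : SCData R) : checkC S →ₗ[R] hatC S :=
  LinearMap.prod (-(LinearMap.fst R S.Irr.carrier (ℕ → S.Red.carrier))) 0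

/-- The chain map `𝔭 : 𝖱[[x⁻¹,x] → Č`, `Σθᵢxⁱ ↦ (Σ_{i≥0} vⁱδ₂θᵢ, Σ_{i≤-1} θᵢxⁱ)`. -/
noncomputable def mapP (S : SCData R) : barC S →ₗ[R] checkC S :=
  LinearMap.prod
    ((Finsupp.lsum ℕ fun i : ℕ => lpow S.v i ∘ₗ S.δ₂) ∘ₗ
      LinearMap.fst R (ℕ →₀ S.Red.carrier) (ℕ → S.Red.carrier))
    (LinearMap.snd R (ℕ →₀ S.Red.carrier) (ℕ → S.Red.carrier))

/-- The coefficient of `xᵉ`, as a linear map `𝖱[[x⁻¹,x] → 𝖱`. -/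
noncomputable def coeffLM (S : SCData R) (e : ℤ) : barC S →ₗ[R] S.Red.carrier :=
  if 0 ≤ e then
    Finsupp.lapply e.toNat ∘ₗ LinearMap.fst R (ℕ →₀ S.Red.carrier) (ℕ → S.Red.carrier)
  else
    LinearMap.proj (-e - 1).toNat ∘ₗ LinearMap.snd R (ℕ →₀ S.Red.carrier) (ℕ → S.Red.carrier)

/-- `𝔍(C~) ⊆ 𝖱[[x⁻¹,x]`, the image of `i⋆ : Ĥ → 𝖱[[x⁻¹,x]` (equal to `𝔦(ker 𝔡̂)`). -/
noncomputable def Jmod (S : SCData R) : Submodule R (barC S) :=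
  (LinearMap.ker (hatD S)).map (mapI S)

/-- `J_i(C~) = { a₀ ∈ 𝖱 | ∃ a₀x^{-i} + a₋₁x^{-i-1} + ⋯ ∈ 𝔍(C~) }`. -/
noncomputable def Jset (S : SCData R) (i : ℤ) : Submodule R S.Red.carrier :=
  ((Jmod S) ⊓ ⨅ (e : ℤ) (_ : -i < e), LinearMap.ker (coeffLM S e)).map (coeffLM S (-i))

/-- The function `d_{C~}(i) = rk_R J_i(C~)`. -/
noncomputable def dFun (S : SCData R) (i : ℤ) : ℕ := Module.finrank R ↥(Jset S i)

/-- The product of two submodules, as a module, is the product of the two modules. -/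
def Submodule.prodLinearEquiv {M N : Type*} [AddCommGroup M] [Module R M] [AddCommGroup N]
    [Module R N] (p : Submodule R M) (q : Submodule R N) : p.prod q ≃ₗ[R] p × q :=
  { Equiv.Set.prod (p : Set M) (q : Set N) with
    map_add' := fun _ _ => rfl
    map_smul' := fun _ _ => rfl }

namespace DirectSum.IsInternal

variable {ι κ : Type*} [DecidableEq ι] [DecidableEq κ]
  {M N : Type*} [AddCommGroup M] [Module R M] [AddCommGroup N] [Module R N]

theorem submodule_comp_equiv {A : ι → Submodule R M} (h : DirectSum.IsInternal A) (e : κ ≃ ι) :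
    DirectSum.IsInternal fun k => A (e k) :=
  DirectSum.isInternal_submodule_of_iSupIndep_of_iSup_eq_top
    (h.submodule_iSupIndep.comp e.injective)
    ((e.iSup_comp (g := A)).trans h.submodule_iSup_eq_top)

theorem submodule_prod {A : ι → Submodule R M} {B : ι → Submodule R N}
    (hA : DirectSum.IsInternal A) (hB : DirectSum.IsInternal B) :
    DirectSum.IsInternal fun i => (A i).prod (B i) := by
  refine DirectSum.isInternal_submodule_of_iSupIndep_of_iSup_eq_top (fun i => ?_) ?_
  · have hle : (⨆ (j) (_ : j ≠ i), (A j).prod (B j)) ≤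
        (⨆ (j) (_ : j ≠ i), A j).prod (⨆ (j) (_ : j ≠ i), B j) :=
      iSup₂_le fun j hj => Submodule.prod_mono
        (le_iSup₂ (f := fun k (_ : k ≠ i) => A k) j hj)
        (le_iSup₂ (f := fun k (_ : k ≠ i) => B k) j hj)
    refine Disjoint.mono_right hle ?_
    rw [disjoint_iff, Submodule.prod_inf_prod, (hA.submodule_iSupIndep i).eq_bot,
      (hB.submodule_iSupIndep i).eq_bot, Submodule.prod_bot]
  · have hfst : Submodule.map (LinearMap.inl R M N) ⊤ ≤ ⨆ i, (A i).prod (B i) := by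
      rw [← hA.submodule_iSup_eq_top, Submodule.map_iSup]
      exact iSup_mono fun i => by rintro _ ⟨x, hx, rfl⟩; exact ⟨hx, zero_mem _⟩
    have hsnd : Submodule.map (LinearMap.inr R M N) ⊤ ≤ ⨆ i, (A i).prod (B i) := by
      rw [← hB.submodule_iSup_eq_top, Submodule.map_iSup]
      exact iSup_mono fun i => by rintro _ ⟨x, hx, rfl⟩; exact ⟨zero_mem _, hx⟩
    refine eq_top_iff.2 fun x _ => ?_
    have hx := add_mem (hfst ⟨x.1, trivial, rfl⟩) (hsnd ⟨x.2, trivial, rfl⟩)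
    simpa using hx

end DirectSum.IsInternal

namespace GradedMod

/-- A product of two finitely generated free graded modules, with the grading of each factor
reindexed by a permutation of `ℤ`, is finitely generated and free. -/
theorem IsFGFree.prod_reindex {M N : GradedMod R} (hM : M.IsFGFree) (hN : N.IsFGFree)
    (e f : ℤ ≃ ℤ) :
    IsFGFree (R := R) { carrier := M.carrier × N.carrier
                        grading := fun j => (M.grading (e j)).prod (N.grading (f j)) } := by
  obtain ⟨hMi, hMfree, hMfin, hMsupp⟩ := hM
  obtain ⟨hNi, hNfree, hNfin, hNsupp⟩ := hN
  refine ⟨(hMi.submodule_comp_equiv e).submodule_prod (hNi.submodule_comp_equiv f),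
    fun i => ?_, fun i => ?_, ?_⟩
  · have := hMfree (e i)
    have := hNfree (f i)
    exact Module.Free.of_equiv ((M.grading (e i)).prodLinearEquiv (N.grading (f i))).symm
  · have := hMfin (e i)
    have := hNfin (f i)
    exact Module.Finite.equiv ((M.grading (e i)).prodLinearEquiv (N.grading (f i))).symm
  · refine ((hMsupp.preimage e.injective.injOn).union
      (hNsupp.preimage f.injective.injOn)).subset fun i hi => ?_
    by_contra hcon
    simp only [Set.mem_union, Set.mem_preimage, Set.mem_ofPred_eq, not_or, not_not] at hcon
    exact hi (by simp only [hcon.1, hcon.2, Submodule.prod_bot])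

theorem IsDeg.apply_mem {M N : GradedMod R} {k : ℤ} {f : M.carrier →ₗ[R] N.carrier}
    (hf : M.IsDeg N k f) {i j : ℤ} (hij : i + k = j) {x : M.carrier} (hx : x ∈ M.grading i) :
    f x ∈ N.grading j :=
  hij ▸ hf i ⟨x, hx, rfl⟩

end GradedMod

namespace SCData

variable {S : SCData R}

theorem Relations.totalDiff_comp_totalDiff (h : S.Relations) :
    S.totalDiff ∘ₗ S.totalDiff = 0 := by
  obtain ⟨hd, h₁, h₂, hv, hr⟩ := h
  refine LinearMap.ext fun ⟨x, y, z⟩ => ?_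
  have hdx := LinearMap.congr_fun hd x
  have hdy := LinearMap.congr_fun hd y
  have h₁x := LinearMap.congr_fun h₁ x
  have h₂z := LinearMap.congr_fun h₂ z
  have hvx := LinearMap.congr_fun hv x
  have hrz := LinearMap.congr_fun hr z
  simp only [LinearMap.comp_apply, LinearMap.add_apply, LinearMap.sub_apply,
    LinearMap.zero_apply] at hdx hdy h₁x h₂z hvx hrz
  refine Prod.ext hdx (Prod.ext ?_ ?_)
  · change S.v (S.d x) - S.d (S.v x - S.d y + S.δ₂ z) + S.δ₂ (S.δ₁ x + S.r z) = 0
    simp only [map_add, map_sub, hdy]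
    linear_combination (norm := module) -hvx - h₂z
  · change S.δ₁ (S.d x) + S.r (S.δ₁ x + S.r z) = 0
    rw [map_add, hrz, add_zero, h₁x]

theorem Relations.susp (h : S.Relations) : S.susp.Relations := by
  obtain ⟨hd, h₁, h₂, hv, hr⟩ := h
  simp only [LinearMap.ext_iff, LinearMap.comp_apply, LinearMap.add_apply, LinearMap.sub_apply,
    LinearMap.zero_apply] at hd h₁ h₂ hv hr
  refine ⟨LinearMap.ext fun ⟨x, z⟩ => Prod.ext ?_ ?_, LinearMap.ext fun ⟨x, z⟩ => ?_,
    LinearMap.ext fun z => Prod.ext ?_ ?_, LinearMap.ext fun ⟨x, z⟩ => Prod.ext ?_ ?_,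
    LinearMap.ext hr⟩
  · change S.d (S.d x - S.δ₂ z) - S.δ₂ (-S.r z) = 0
    simp only [map_sub, map_neg, hd]
    linear_combination (norm := module) -h₂ z
  · change -S.r (-S.r z) = 0
    simp [hr]
  · change -S.r z + S.r z = 0
    simp
  · change S.d (S.v (S.δ₂ z)) - S.δ₂ (S.δ₁ (S.δ₂ z)) - S.v (S.δ₂ (S.r z)) = 0
    have := congrArg S.v (h₂ z)
    rw [map_sub, map_zero] at this
    linear_combination (norm := module) hv (S.δ₂ z) + this
  · change -S.r (S.δ₁ (S.δ₂ z)) - S.δ₁ (S.δ₂ (S.r z)) = 0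
    have := congrArg S.δ₁ (h₂ z)
    rw [map_sub, map_zero] at this
    linear_combination (norm := module) this - h₁ (S.δ₂ z)
  · change S.d (S.v x) - S.δ₂ (S.δ₁ x) - S.v (S.d x - S.δ₂ z) - S.v (S.δ₂ z) = 0
    rw [map_sub]
    linear_combination (norm := module) hv x
  · change -S.r (S.δ₁ x) - S.δ₁ (S.d x - S.δ₂ z) - S.δ₁ (S.δ₂ z) = 0
    rw [map_sub]
    linear_combination (norm := module) -h₁ x

theorem Relations.negSusp (h : S.Relations) : S.negSusp.Relations := by
  obtain ⟨hd, h₁, h₂, hv, hr⟩ := h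
  simp only [LinearMap.ext_iff, LinearMap.comp_apply, LinearMap.add_apply, LinearMap.sub_apply,
    LinearMap.zero_apply] at hd h₁ h₂ hv hr
  refine ⟨LinearMap.ext fun ⟨x, z⟩ => Prod.ext (hd x) ?_, LinearMap.ext fun ⟨x, z⟩ => ?_,
    LinearMap.ext fun z => Prod.ext ?_ ?_, LinearMap.ext fun ⟨x, z⟩ => Prod.ext ?_ ?_,
    LinearMap.ext hr⟩
  · change S.δ₁ (S.d x) + S.r (S.δ₁ x + S.r z) = 0
    rw [map_add, hr, add_zero, h₁]
  · change S.δ₁ (S.v (S.d x)) + S.δ₁ (S.δ₂ (S.δ₁ x + S.r z)) +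
      S.r (S.δ₁ (S.v x) + S.δ₁ (S.δ₂ z)) = 0
    have hvx := congrArg S.δ₁ (hv x)
    have h₂z := congrArg S.δ₁ (h₂ z)
    simp only [map_sub, map_add, map_zero] at hvx h₂z ⊢
    linear_combination (norm := module) h₁ (S.v x) + h₁ (S.δ₂ z) - hvx - h₂z
  · change S.d 0 - 0 = 0
    simp
  · change S.δ₁ 0 + S.r z - S.r z = 0
    simp
  · change S.d (S.v x + S.δ₂ z) - (S.v (S.d x) + S.δ₂ (S.δ₁ x + S.r z)) - 0 = 0
    simp only [map_add]
    linear_combination (norm := module) hv x + h₂ z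
  · change S.δ₁ (S.v x + S.δ₂ z) + S.r 0 - 0 - (S.δ₁ (S.v x) + S.δ₁ (S.δ₂ z)) = 0
    simp

theorem Degrees.susp (h : S.Degrees) : S.susp.Degrees := by
  obtain ⟨hd, hv, h₁, h₂, hr⟩ := h
  refine ⟨?_, ?_, ?_, ?_, hr⟩
  · rintro i _ ⟨⟨x, z⟩, ⟨hx, hz⟩, rfl⟩
    exact ⟨sub_mem (hd.apply_mem (by ring) hx) (h₂.apply_mem (by ring) hz),
      neg_mem (hr.apply_mem (by ring) hz)⟩
  · rintro i _ ⟨⟨x, z⟩, ⟨hx, hz⟩, rfl⟩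
    exact ⟨hv.apply_mem (by ring) hx, h₁.apply_mem (by ring) hx⟩
  · rintro i _ ⟨⟨x, z⟩, ⟨hx, hz⟩, rfl⟩
    exact hz
  · rintro i _ ⟨z, hz, rfl⟩
    exact ⟨hv.apply_mem (by ring) (h₂.apply_mem rfl hz),
      h₁.apply_mem (by ring) (h₂.apply_mem rfl hz)⟩

theorem Degrees.negSusp (h : S.Degrees) : S.negSusp.Degrees := by
  obtain ⟨hd, hv, h₁, h₂, hr⟩ := h
  refine ⟨?_, ?_, ?_, ?_, hr⟩
  · rintro i _ ⟨⟨x, z⟩, ⟨hx, hz⟩, rfl⟩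
    exact ⟨hd.apply_mem (by ring) hx,
      add_mem (h₁.apply_mem (by ring) hx) (hr.apply_mem (by ring) hz)⟩
  · rintro i _ ⟨⟨x, z⟩, ⟨hx, hz⟩, rfl⟩
    exact ⟨add_mem (hv.apply_mem (by ring) hx) (h₂.apply_mem (by ring) hz), zero_mem _⟩
  · rintro i _ ⟨⟨x, z⟩, ⟨hx, hz⟩, rfl⟩
    exact add_mem (h₁.apply_mem (by ring) (hv.apply_mem rfl hx))
      (h₁.apply_mem (by ring) (h₂.apply_mem rfl hz))
  · rintro i _ ⟨z, hz, rfl⟩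
    refine ⟨zero_mem _, ?_⟩
    change z ∈ S.Red.grading (i + -2 + 2)
    rwa [neg_add_cancel_right]

theorem IsSComplex.susp (h : S.IsSComplex) : S.susp.IsSComplex :=
  ⟨h.1.prod_reindex h.2.1 (Equiv.subRight 2) (Equiv.subRight 1), h.2.1, h.2.2.1.susp,
    h.2.2.2.susp⟩

theorem IsSComplex.negSusp (h : S.IsSComplex) : S.negSusp.IsSComplex :=
  ⟨h.1.prod_reindex h.2.1 (Equiv.addRight 2) (Equiv.addRight 2), h.2.1, h.2.2.1.negSusp,
    h.2.2.2.negSusp⟩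

end SCData

/-- For an `S`-complex, the suspension differential and the negative
suspension differential both square to zero; consequently the suspension and the negative
suspension are again `S`-complexes. -/
theorem susp_negSusp_differential_squares_to_zero
    {R : Type u} [CommRing R] (S : SCData R) (hrel : S.Relations) :
    S.susp.totalDiff ∘ₗ S.susp.totalDiff = 0 ∧
    S.negSusp.totalDiff ∘ₗ S.negSusp.totalDiff = 0 ∧
    (S.IsSComplex → S.susp.IsSComplex ∧ S.negSusp.IsSComplex) := by
  exact ⟨hrel.susp.totalDiff_comp_totalDiff, hrel.negSusp.totalDiff_comp_totalDiff,
    fun h => ⟨h.susp, h.negSusp⟩⟩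
end

section
/- Let λ~: C~ → C~′ be a morphism of S-complexes over a commutative ring R with components (λ, μ, Δ₁, Δ₂, ρ). Then the block matrix λ~_Σ = [[λ, Δ₂, 0, 0, 0], [0, ρ, 0, 0, 0], [μ, 0, λ, Δ₂, μδ₂ + v′Δ₂], [Δ₁, 0, 0, ρ, Δ₁δ₂ + δ₁′Δ₂], [0, 0, 0, 0, ρ]] (with respect to the block decompositions ΣC~ = (C[-2] ⊕ 𝖱[-1]) ⊕ (C[-3] ⊕ 𝖱[-2]) ⊕ 𝖱 and likewise for ΣC~′) defines a morphism of S-complexes Σλ~ := λ~_Σ : ΣC~ → ΣC~′; that is, d~′_Σ λ~_Σ = λ~_Σ d~_Σ and λ~_Σ commutes with the χ-maps. -/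
set_option maxHeartbeats 1000000

open Function

universe u

variable {R : Type u} [CommRing R]

namespace SMap

/-- The component relations of a morphism of `S`-complexes make its total map a chain map. -/
theorem IsMor.totalDiff_comp_morTotal {R : Type u} [CommRing R] {S T : SCData R}
    {f : SMap S T} (hf : f.IsMor) :
    T.totalDiff ∘ₗ morTotal f = morTotal f ∘ₗ S.totalDiff := by
  obtain ⟨h1, h2, h3, h4, h5⟩ := hf
  simp only [LinearMap.ext_iff, LinearMap.add_apply, LinearMap.sub_apply, LinearMap.comp_apply,
    LinearMap.zero_apply] at h1 h2 h3 h4 h5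
  refine LinearMap.ext fun x => ?_
  obtain ⟨a, b, c⟩ := x
  refine Prod.ext ?_ (Prod.ext ?_ ?_)
  · exact sub_eq_zero.mp (h1 a)
  · change T.v (f.lam a) - T.d (f.mu a + f.lam b + f.del2 c) + T.δ₂ (f.del1 a + f.rho c) =
      f.mu (S.d a) + f.lam (S.v a - S.d b + S.δ₂ c) + f.del2 (S.δ₁ a + S.r c)
    simp only [map_add, map_sub]
    linear_combination (norm := module) -h4 a - h1 b - h3 c
  · change T.δ₁ (f.lam a) + T.r (f.del1 a + f.rho c) =
      f.del1 (S.d a) + f.rho (S.δ₁ a + S.r c)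
    simp only [map_add]
    linear_combination (norm := module) -h2 a - h5 c

/-- The total map of a map in block form commutes with the `χ`-maps. -/
theorem totalChi_comp_morTotal {R : Type u} [CommRing R] {S T : SCData R} (f : SMap S T) :
    T.totalChi ∘ₗ morTotal f = morTotal f ∘ₗ S.totalChi := by
  refine LinearMap.ext fun x => ?_
  obtain ⟨a, b, c⟩ := x
  refine Prod.ext ?_ (Prod.ext ?_ ?_)
  · change (0 : T.Irr.carrier) = f.lam 0
    simp
  · change f.lam a = f.mu 0 + f.lam a + f.del2 0
    simp
  · change (0 : T.Red.carrier) = f.del1 0 + f.rho 0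
    simp

/-- The suspended components satisfy the morphism relations. -/
theorem IsMor.suspMap {R : Type u} [CommRing R] {S T : SCData R} {f : SMap S T}
    (hf : f.IsMor) (hS : S.Relations) (hT : T.Relations) : (suspMap f).IsMor := by
  obtain ⟨h1, h2, h3, h4, h5⟩ := hf
  obtain ⟨-, -, hSδ₂, -, -⟩ := hS
  obtain ⟨-, hTδ₁, -, hTv, -⟩ := hT
  simp only [LinearMap.ext_iff, LinearMap.add_apply, LinearMap.sub_apply, LinearMap.comp_apply,
    LinearMap.zero_apply] at h1 h2 h3 h4 h5 hSδ₂ hTδ₁ hTv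
  refine ⟨LinearMap.ext fun x => ?_, LinearMap.ext fun x => ?_, LinearMap.ext fun x => ?_,
    LinearMap.ext fun x => ?_, LinearMap.ext h5⟩
  · obtain ⟨c, x⟩ := x
    refine Prod.ext ?_ ?_
    · change (T.d (f.lam c + f.del2 x) - T.δ₂ (f.rho x)) -
        (f.lam (S.d c - S.δ₂ x) + f.del2 (-S.r x)) = 0
      simp only [map_add, map_sub, map_neg]
      linear_combination (norm := module) h1 c + h3 x
    · change -T.r (f.rho x) - f.rho (-S.r x) = 0
      simp only [map_neg]
      linear_combination (norm := module) h5 x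
  · obtain ⟨c, x⟩ := x
    change (0 : T.Red.carrier) + f.rho x - f.rho x - T.r 0 = 0
    simp
  · refine Prod.ext ?_ ?_
    · change (T.d (f.mu (S.δ₂ x) + T.v (f.del2 x)) -
          T.δ₂ (f.del1 (S.δ₂ x) + T.δ₁ (f.del2 x))) - T.v (T.δ₂ (f.rho x)) +
        (f.lam (S.v (S.δ₂ x)) + f.del2 (S.δ₁ (S.δ₂ x))) +
        (f.mu (S.δ₂ (S.r x)) + T.v (f.del2 (S.r x))) = 0
      have hv := congrArg T.v (h3 x)
      have hmu := congrArg f.mu (hSδ₂ x)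
      simp only [map_add, map_sub, map_zero] at hv hmu ⊢
      linear_combination (norm := module) h4 (S.δ₂ x) + hTv (f.del2 x) + hv - hmu
    · change -T.r (f.del1 (S.δ₂ x) + T.δ₁ (f.del2 x)) - T.δ₁ (T.δ₂ (f.rho x)) +
        f.rho (S.δ₁ (S.δ₂ x)) + (f.del1 (S.δ₂ (S.r x)) + T.δ₁ (f.del2 (S.r x))) = 0
      have hδ₁ := congrArg T.δ₁ (h3 x)
      have hdel1 := congrArg f.del1 (hSδ₂ x)
      simp only [map_add, map_sub, map_zero] at hδ₁ hdel1 ⊢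
      linear_combination (norm := module) h2 (S.δ₂ x) - hTδ₁ (f.del2 x) + hδ₁ - hdel1
  · obtain ⟨c, x⟩ := x
    refine Prod.ext ?_ ?_
    · change f.mu (S.d c - S.δ₂ x) + (T.d (f.mu c) - T.δ₂ (f.del1 c)) +
        (f.lam (S.v c) + f.del2 (S.δ₁ c)) - T.v (f.lam c + f.del2 x) +
        (f.mu (S.δ₂ x) + T.v (f.del2 x)) - T.v (T.δ₂ 0) = 0
      simp only [map_add, map_sub, map_zero]
      linear_combination (norm := module) h4 c
    · change f.del1 (S.d c - S.δ₂ x) + -T.r (f.del1 c) + f.rho (S.δ₁ c) -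
        T.δ₁ (f.lam c + f.del2 x) + (f.del1 (S.δ₂ x) + T.δ₁ (f.del2 x)) - T.δ₁ (T.δ₂ 0) = 0
      simp only [map_add, map_sub, map_zero]
      linear_combination (norm := module) h2 c

end SMap

namespace GradedMod.IsDeg

/-- A map of degree `k` sends the degree `i` part into the degree `j` part when `j = i + k`. -/
theorem apply_mem_s1 {R : Type u} [CommRing R] {M N : GradedMod R} {k : ℤ}
    {f : M.carrier →ₗ[R] N.carrier} (hf : M.IsDeg N k f) {i j : ℤ} (hij : j = i + k)
    {x : M.carrier} (hx : x ∈ M.grading i) : f x ∈ N.grading j :=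
  hij ▸ hf i (Submodule.mem_map_of_mem hx)

end GradedMod.IsDeg

/-- The suspension of a degree `0` map has degree `0`. -/
theorem SMap.DegreesAt.suspMap {R : Type u} [CommRing R] {S T : SCData R} {f : SMap S T}
    (hf : f.DegreesAt 0) (hS : S.Degrees) (hT : T.Degrees) : (suspMap f).DegreesAt 0 := by
  obtain ⟨hlam, hmu, hdel1, hdel2, hrho⟩ := hf
  obtain ⟨-, -, -, hSδ₂, -⟩ := hS
  obtain ⟨-, hTv, hTδ₁, -, -⟩ := hT
  refine ⟨?_, ?_, ?_, ?_, hrho⟩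
  · rintro i _ ⟨⟨c, x⟩, ⟨hc, hx⟩, rfl⟩
    exact ⟨add_mem (hlam.apply_mem_s1 (by ring) hc) (hdel2.apply_mem_s1 (by ring) hx),
      hrho.apply_mem_s1 (by ring) hx⟩
  · rintro i _ ⟨⟨c, x⟩, ⟨hc, -⟩, rfl⟩
    exact ⟨hmu.apply_mem_s1 (by ring) hc, hdel1.apply_mem_s1 (by ring) hc⟩
  · rintro i _ ⟨x, -, rfl⟩
    exact zero_mem _
  · rintro i _ ⟨x, hx, rfl⟩
    have hδ₂x := hSδ₂.apply_mem_s1 rfl hx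
    have hdel2x := hdel2.apply_mem_s1 rfl hx
    exact ⟨add_mem (hmu.apply_mem_s1 (by ring) hδ₂x) (hTv.apply_mem_s1 (by ring) hdel2x),
      add_mem (hdel1.apply_mem_s1 (by ring) hδ₂x) (hTδ₁.apply_mem_s1 (by ring) hdel2x)⟩

/-- The suspension `λ~_Σ` of a morphism of `S`-complexes is a morphism of
`S`-complexes `ΣC~ → ΣC~'`: it commutes with the suspended differentials and with the
`χ`-maps, and has degree `0`. -/
theorem suspMap_isMor {R : Type u} [CommRing R] {S T : SCData R}
    (hS : S.IsSComplex) (hT : T.IsSComplex)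
    (f : SMap S T) (hf : f.IsMor) (hfdeg : f.DegreesAt 0) :
    (suspMap f).IsMor ∧ (suspMap f).DegreesAt 0 ∧
    T.susp.totalDiff ∘ₗ morTotal (suspMap f) = morTotal (suspMap f) ∘ₗ S.susp.totalDiff ∧
    T.susp.totalChi ∘ₗ morTotal (suspMap f) = morTotal (suspMap f) ∘ₗ S.susp.totalChi := by
  have hmor := hf.suspMap hS.2.2.2 hT.2.2.2
  exact ⟨hmor, hfdeg.suspMap hS.2.2.1 hT.2.2.1, hmor.totalDiff_comp_morTotal,
    (suspMap f).totalChi_comp_morTotal⟩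
end

section
/- Let λ~, λ~′: C~ → C~′ be morphisms of S-complexes over a commutative ring R, and let K~ be an S-chain homotopy from λ~ to λ~′ with components (K, L, M₁, M₂, J), so that d~′K~ + K~d~ = λ~ − λ~′ and χ′K~ + K~χ = 0. Then the block matrix K~_Σ = [[K, −M₂, 0, 0, 0], [0, −J, 0, 0, 0], [L, 0, −K, M₂, v′M₂ + Lδ₂], [M₁, 0, 0, J, δ₁′M₂ + M₁δ₂], [0, 0, 0, 0, J]] is an S-chain homotopy from Σλ~ to Σλ~′, i.e. d~′_Σ K~_Σ + K~_Σ d~_Σ = λ~_Σ − λ~′_Σ and χ′_Σ K~_Σ + K~_Σ χ_Σ = 0. -/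
set_option maxHeartbeats 1000000

open Function

universe u

variable {R : Type u} [CommRing R]

namespace SMap

variable {S T : SCData R}

/-- The component relations of an `S`-chain homotopy assemble to
`d~' K~ + K~ d~ = λ~ - λ~'`. -/
theorem IsHtpyFrom.total_eq {K f g : SMap S T} (hK : IsHtpyFrom K f g) :
    T.totalDiff ∘ₗ htpTotal K + htpTotal K ∘ₗ S.totalDiff = morTotal f - morTotal g := by
  obtain ⟨hlam, hdel1, hdel2, hmu, hrho⟩ := hK
  refine LinearMap.ext fun ⟨a, b, c⟩ => ?_
  have hlam_a := LinearMap.congr_fun hlam a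
  have hlam_b := LinearMap.congr_fun hlam b
  have hdel1_a := LinearMap.congr_fun hdel1 a
  have hdel2_c := LinearMap.congr_fun hdel2 c
  have hmu_a := LinearMap.congr_fun hmu a
  have hrho_c := LinearMap.congr_fun hrho c
  simp only [LinearMap.add_apply, LinearMap.sub_apply, LinearMap.neg_apply, LinearMap.comp_apply,
    LinearMap.zero_apply] at hlam_a hlam_b hdel1_a hdel2_c hmu_a hrho_c
  refine Prod.ext ?_ (Prod.ext ?_ ?_)
  · change T.d (K.lam a) + K.lam (S.d a) = f.lam a - g.lam a
    linear_combination (norm := abel) hlam_a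
  · change T.v (K.lam a) - T.d (K.mu a - K.lam b + K.del2 c) + T.δ₂ (K.del1 a + K.rho c) +
        (K.mu (S.d a) - K.lam (S.v a - S.d b + S.δ₂ c) + K.del2 (S.δ₁ a + S.r c)) =
      (f.mu a + f.lam b + f.del2 c) - (g.mu a + g.lam b + g.del2 c)
    simp only [map_add, map_sub]
    linear_combination (norm := abel) hmu_a + hlam_b + hdel2_c
  · change T.δ₁ (K.lam a) + T.r (K.del1 a + K.rho c) +
        (K.del1 (S.d a) + K.rho (S.δ₁ a + S.r c)) =
      (f.del1 a + f.rho c) - (g.del1 a + g.rho c)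
    simp only [map_add]
    linear_combination (norm := abel) hdel1_a + hrho_c

/-- A map in the block form of a homotopy anticommutes with `χ`. -/
theorem totalChi_comp_htpTotal_add (K : SMap S T) :
    T.totalChi ∘ₗ htpTotal K + htpTotal K ∘ₗ S.totalChi = 0 := by
  refine LinearMap.ext fun ⟨a, b, c⟩ => ?_
  refine Prod.ext ?_ (Prod.ext ?_ ?_)
  · change (0 : T.Irr.carrier) + K.lam 0 = 0
    simp
  · change K.lam a + (K.mu 0 - K.lam a + K.del2 0) = 0
    simp
  · change (0 : T.Red.carrier) + (K.del1 0 + K.rho 0) = 0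
    simp

/-- Suspension preserves the component relations of an `S`-chain homotopy. -/
theorem IsHtpyFrom.suspHtpy (hS : S.Relations) (hT : T.Relations) {K f g : SMap S T}
    (hK : IsHtpyFrom K f g) :
    IsHtpyFrom (suspHtpy K) (suspMap f) (suspMap g) := by
  obtain ⟨-, -, hSδ₂, -, -⟩ := hS
  obtain ⟨-, hTδ₁, -, hTv, -⟩ := hT
  obtain ⟨hlam, hdel1, hdel2, hmu, hrho⟩ := hK
  replace hSδ₂ x := LinearMap.congr_fun hSδ₂ x
  replace hTδ₁ x := LinearMap.congr_fun hTδ₁ x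
  replace hTv x := LinearMap.congr_fun hTv x
  replace hlam x := LinearMap.congr_fun hlam x
  replace hdel1 x := LinearMap.congr_fun hdel1 x
  replace hdel2 x := LinearMap.congr_fun hdel2 x
  replace hmu x := LinearMap.congr_fun hmu x
  replace hrho x := LinearMap.congr_fun hrho x
  simp only [LinearMap.add_apply, LinearMap.sub_apply, LinearMap.neg_apply, LinearMap.comp_apply,
    LinearMap.zero_apply] at hSδ₂ hTδ₁ hTv hlam hdel1 hdel2 hmu hrho
  refine ⟨LinearMap.ext fun ⟨a, b⟩ => ?_, LinearMap.ext fun ⟨a, b⟩ => ?_,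
    LinearMap.ext fun c => ?_, LinearMap.ext fun ⟨a, b⟩ => ?_, LinearMap.ext fun c => hrho c⟩
  · refine Prod.ext ?_ ?_
    · change T.d (K.lam a - K.del2 b) - T.δ₂ (-K.rho b) +
          (K.lam (S.d a - S.δ₂ b) - K.del2 (-S.r b)) -
          (f.lam a + f.del2 b) + (g.lam a + g.del2 b) = 0
      simp only [map_sub, map_neg]
      linear_combination (norm := abel) hlam a + hdel2 b
    · change -T.r (-K.rho b) + -K.rho (-S.r b) - f.rho b + g.rho b = 0
      simp only [map_neg]
      linear_combination (norm := abel) hrho b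
  · change -K.rho b + T.r 0 + 0 + K.rho b - 0 + 0 = 0
    simp
  · have hdel2_v := congrArg T.v (hdel2 c)
    have hdel2_δ₁ := congrArg T.δ₁ (hdel2 c)
    have hδ₂_mu := congrArg K.mu (hSδ₂ c)
    have hδ₂_del1 := congrArg K.del1 (hSδ₂ c)
    simp only [map_add, map_sub, map_neg, map_zero] at hdel2_v hdel2_δ₁ hδ₂_mu hδ₂_del1
    refine Prod.ext ?_ ?_
    · change -(T.d (T.v (K.del2 c) + K.mu (S.δ₂ c)) - T.δ₂ (T.δ₁ (K.del2 c) + K.del1 (S.δ₂ c))) +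
          T.v (T.δ₂ (K.rho c)) - (K.lam (S.v (S.δ₂ c)) - K.del2 (S.δ₁ (S.δ₂ c))) +
          (T.v (K.del2 (S.r c)) + K.mu (S.δ₂ (S.r c))) -
          (f.mu (S.δ₂ c) + T.v (f.del2 c)) + (g.mu (S.δ₂ c) + T.v (g.del2 c)) = 0
      simp only [map_add]
      linear_combination (norm := abel) hdel2_v + hmu (S.δ₂ c) - hTv (K.del2 c) - hδ₂_mu
    · change -(-T.r (T.δ₁ (K.del2 c) + K.del1 (S.δ₂ c))) + T.δ₁ (T.δ₂ (K.rho c)) -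
          -K.rho (S.δ₁ (S.δ₂ c)) + (T.δ₁ (K.del2 (S.r c)) + K.del1 (S.δ₂ (S.r c))) -
          (f.del1 (S.δ₂ c) + T.δ₁ (f.del2 c)) + (g.del1 (S.δ₂ c) + T.δ₁ (g.del2 c)) = 0
      simp only [map_add]
      linear_combination (norm := abel) hdel2_δ₁ + hdel1 (S.δ₂ c) + hTδ₁ (K.del2 c) - hδ₂_del1
  · refine Prod.ext ?_ ?_
    · change T.v (K.lam a - K.del2 b) - (T.d (K.mu a) - T.δ₂ (K.del1 a)) + T.v (T.δ₂ 0) +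
          K.mu (S.d a - S.δ₂ b) - (K.lam (S.v a) - K.del2 (S.δ₁ a)) +
          (T.v (K.del2 b) + K.mu (S.δ₂ b)) - f.mu a + g.mu a = 0
      simp only [map_sub, map_zero]
      linear_combination (norm := abel) hmu a
    · change T.δ₁ (K.lam a - K.del2 b) - -T.r (K.del1 a) + T.δ₁ (T.δ₂ 0) +
          K.del1 (S.d a - S.δ₂ b) - -K.rho (S.δ₁ a) +
          (T.δ₁ (K.del2 b) + K.del1 (S.δ₂ b)) - f.del1 a + g.del1 a = 0
      simp only [map_sub, map_zero]
      linear_combination (norm := abel) hdel1 a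

end SMap

/-- The suspension `K~_Σ` of an `S`-chain homotopy `K~` from `λ~` to `λ~'`
is an `S`-chain homotopy from `Σλ~` to `Σλ~'`. -/
theorem suspHtpy_isHtpy {R : Type u} [CommRing R] {S T : SCData R}
    (hS : S.IsSComplex) (hT : T.IsSComplex)
    (f g : SMap S T) (hf : f.IsMor) (hfd : f.DegreesAt 0) (hg : g.IsMor) (hgd : g.DegreesAt 0)
    (K : SMap S T) (hK : SMap.IsHtpyFrom K f g) (hKd : K.DegreesAt 1) :
    SMap.IsHtpyFrom (suspHtpy K) (suspMap f) (suspMap g) ∧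
    T.susp.totalDiff ∘ₗ htpTotal (suspHtpy K) + htpTotal (suspHtpy K) ∘ₗ S.susp.totalDiff =
      morTotal (suspMap f) - morTotal (suspMap g) ∧
    T.susp.totalChi ∘ₗ htpTotal (suspHtpy K) + htpTotal (suspHtpy K) ∘ₗ S.susp.totalChi = 0 := by
  have h := hK.suspHtpy hS.2.2.2 hT.2.2.2
  exact ⟨h, h.total_eq, SMap.totalChi_comp_htpTotal_add _⟩
end
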